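/- (Appendix Lemma for Theorem 1.) Let P̂ be a second transition dynamics and Ĵ the expected total discounted cost under P̂. Fix a policy π_n, α ≥ 0, and let T = {π : E_{s∼d_{π_n}}[D_TV(π(·|s), π_n(·|s))] ≤ α} be the trust region around π_n (with d_{π_n} the visitation distribution under the true dynamics P). Suppose η_n minimizes Ĵ over T and let η*_n be any policy in T. Then J(η_n) − J(η*_n) ≤ (γ/(2(1−γ)²)) · ( E_{(s,a)∼d_{η_n} η_n}[‖P̂_{s,a} − P_{s,a}‖₁] + E_{(s,a)∼d_{η*_n} η*_n}[‖P̂_{s,a} − P_{s,a}‖₁] ), where all visitation distributions and J are taken under the true dynamics P. -/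

import Mathlib

open scoped BigOperators

noncomputable section

/-- `p` is a probability distribution on a finite type. -/
def IsDist {X : Type*} [Fintype X] (p : X → ℝ) : Prop :=
  (∀ x, 0 ≤ p x) ∧ ∑ x, p x = 1

/-- `P` is a transition dynamics: `P s a` is a distribution over next states. -/
def IsDynamics {S A : Type*} [Fintype S] (P : S → A → S → ℝ) : Prop :=
  ∀ s a, IsDist (P s a)

/-- `π` is a (stochastic) policy: `π s` is a distribution over actions. -/
def IsPolicy {S A : Type*} [Fintype A] (π : S → A → ℝ) : Prop :=
  ∀ s, IsDist (π s)

/-- One-step evolution of a state distribution under policy `π` and dynamics `P`. -/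
def step {S A : Type*} [Fintype S] [Fintype A]
    (P : S → A → S → ℝ) (π : S → A → ℝ) (d : S → ℝ) : S → ℝ :=
  fun s' => ∑ s, ∑ a, d s * π s a * P s a s'

/-- The time-`t` state distribution `d_π^t` starting from `ρ₀`. -/
def stateDist {S A : Type*} [Fintype S] [Fintype A]
    (P : S → A → S → ℝ) (π : S → A → ℝ) (ρ₀ : S → ℝ) : ℕ → S → ℝ
  | 0 => ρ₀
  | t + 1 => step P π (stateDist P π ρ₀ t)

/-- Discounted state visitation distribution `d_π = (1-γ) Σ_t γ^t d_π^t`. -/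
def visit {S A : Type*} [Fintype S] [Fintype A]
    (γ : ℝ) (P : S → A → S → ℝ) (π : S → A → ℝ) (ρ₀ : S → ℝ) : S → ℝ :=
  fun s => (1 - γ) * ∑' t : ℕ, γ ^ t * stateDist P π ρ₀ t s

/-- Expected cost of one step when the state is distributed as `d` and actions follow `π`. -/
def expCost {S A : Type*} [Fintype S] [Fintype A]
    (c : S → A → ℝ) (π : S → A → ℝ) (d : S → ℝ) : ℝ :=
  ∑ s, ∑ a, d s * π s a * c s a

/-- Value function `V^π(s₀)`: expected total discounted cost starting at `s₀`. -/
def Vf {S A : Type*} [Fintype S] [Fintype A] [DecidableEq S]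
    (γ : ℝ) (P : S → A → S → ℝ) (c : S → A → ℝ) (π : S → A → ℝ) (s₀ : S) : ℝ :=
  ∑' t : ℕ, γ ^ t * expCost c π (stateDist P π (fun s => if s = s₀ then 1 else 0) t)

/-- Objective `J(π) = E_{s∼ρ₀}[V^π(s)]`. -/
def Jf {S A : Type*} [Fintype S] [Fintype A] [DecidableEq S]
    (γ : ℝ) (P : S → A → S → ℝ) (c : S → A → ℝ) (ρ₀ : S → ℝ) (π : S → A → ℝ) : ℝ :=
  ∑ s, ρ₀ s * Vf γ P c π s

/-- State-action value `Q^π(s,a) = c(s,a) + γ E_{s'∼P_{s,a}}[V^π(s')]`. -/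
def Qf {S A : Type*} [Fintype S] [Fintype A] [DecidableEq S]
    (γ : ℝ) (P : S → A → S → ℝ) (c : S → A → ℝ) (π : S → A → ℝ) (s : S) (a : A) : ℝ :=
  c s a + γ * ∑ s', P s a s' * Vf γ P c π s'

/-- Disadvantage function `A^π(s,a) = Q^π(s,a) - V^π(s)`. -/
def Adv {S A : Type*} [Fintype S] [Fintype A] [DecidableEq S]
    (γ : ℝ) (P : S → A → S → ℝ) (c : S → A → ℝ) (π : S → A → ℝ) (s : S) (a : A) : ℝ :=
  Qf γ P c π s a - Vf γ P c π s

theorem IsDist.le_one {X : Type*} [Fintype X] {p : X → ℝ} (hp : IsDist p) (x : X) : p x ≤ 1 :=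
  hp.2 ▸ Finset.single_le_sum (fun y _ => hp.1 y) (Finset.mem_univ x)

theorem IsDist.step {S A : Type*} [Fintype S] [Fintype A] {P : S → A → S → ℝ} {π : S → A → ℝ}
    {d : S → ℝ} (hP : IsDynamics P) (hπ : IsPolicy π) (hd : IsDist d) : IsDist (step P π d) := by
  refine ⟨fun s' => Finset.sum_nonneg fun s _ => Finset.sum_nonneg fun a _ =>
    mul_nonneg (mul_nonneg (hd.1 s) ((hπ s).1 a)) ((hP s a).1 s'), ?_⟩
  unfold _root_.step
  rw [Finset.sum_comm, ← hd.2]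
  refine Finset.sum_congr rfl fun s _ => ?_
  rw [Finset.sum_comm]
  simp only [← Finset.mul_sum, (hP s _).2, (hπ s).2, mul_one]

theorem IsDist.stateDist {S A : Type*} [Fintype S] [Fintype A] {P : S → A → S → ℝ}
    {π : S → A → ℝ} {d : S → ℝ} (hP : IsDynamics P) (hπ : IsPolicy π) (hd : IsDist d) (t : ℕ) :
    IsDist (stateDist P π d t) := by
  induction t with
  | zero => exact hd
  | succ t ih => exact ih.step hP hπ

theorem isDist_ite_eq {S : Type*} [Fintype S] [DecidableEq S] (s₀ : S) :
    IsDist (fun s => if s = s₀ then (1 : ℝ) else 0) :=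
  ⟨fun s => by positivity, by simp⟩

theorem stateDist_zero {S A : Type*} [Fintype S] [Fintype A] (P : S → A → S → ℝ)
    (π : S → A → ℝ) (d : S → ℝ) : stateDist P π d 0 = d :=
  rfl

theorem stateDist_succ' {S A : Type*} [Fintype S] [Fintype A] (P : S → A → S → ℝ)
    (π : S → A → ℝ) (d : S → ℝ) (t : ℕ) :
    stateDist P π d (t + 1) = stateDist P π (step P π d) t := by
  induction t with
  | zero => rfl
  | succ t ih => rw [stateDist, ih, stateDist]

theorem stateDist_eq_sum {S A : Type*} [Fintype S] [Fintype A] [DecidableEq S]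
    (P : S → A → S → ℝ) (π : S → A → ℝ) (d : S → ℝ) (t : ℕ) (s : S) :
    stateDist P π d t s =
      ∑ s₀, d s₀ * stateDist P π (fun s => if s = s₀ then 1 else 0) t s := by
  induction t generalizing s with
  | zero => simp [stateDist]
  | succ t ih =>
    simp only [stateDist, step, ih, Finset.mul_sum, Finset.sum_mul]
    rw [Finset.sum_comm_cycle]
    refine Finset.sum_congr rfl fun s₀ _ => Finset.sum_congr rfl fun s _ =>
      Finset.sum_congr rfl fun a _ => by ring

theorem expCost_stateDist_eq_sum {S A : Type*} [Fintype S] [Fintype A] [DecidableEq S]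
    (P : S → A → S → ℝ) (c : S → A → ℝ) (π : S → A → ℝ) (d : S → ℝ) (t : ℕ) :
    expCost c π (stateDist P π d t) =
      ∑ s₀, d s₀ * expCost c π (stateDist P π (fun s => if s = s₀ then 1 else 0) t) := by
  simp only [expCost, stateDist_eq_sum P π d t, Finset.mul_sum, Finset.sum_mul]
  rw [Finset.sum_comm_cycle]
  refine Finset.sum_congr rfl fun s₀ _ => Finset.sum_congr rfl fun s _ =>
    Finset.sum_congr rfl fun a _ => by ring

theorem summable_pow_mul_of_mem_Icc {γ M : ℝ} (hγ : 0 ≤ γ) (hγ' : γ < 1) {f : ℕ → ℝ}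
    (hf : ∀ t, f t ∈ Set.Icc 0 M) : Summable fun t => γ ^ t * f t :=
  ((summable_geometric_of_lt_one hγ hγ').mul_right M).of_nonneg_of_le
    (fun t => mul_nonneg (pow_nonneg hγ t) (hf t).1)
    fun t => mul_le_mul_of_nonneg_left (hf t).2 (pow_nonneg hγ t)

theorem IsDist.sum_mul_mem_Icc {X : Type*} [Fintype X] {p : X → ℝ} (hp : IsDist p) {M : ℝ}
    {v : X → ℝ} (hv : ∀ x, v x ∈ Set.Icc 0 M) : ∑ x, p x * v x ∈ Set.Icc 0 M := by
  refine ⟨Finset.sum_nonneg fun x _ => mul_nonneg (hp.1 x) (hv x).1, ?_⟩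
  calc ∑ x, p x * v x ≤ ∑ x, p x * M :=
        Finset.sum_le_sum fun x _ => mul_le_mul_of_nonneg_left (hv x).2 (hp.1 x)
    _ = M := by rw [← Finset.sum_mul, hp.2, one_mul]

theorem IsDist.expCost_mem_Icc {S A : Type*} [Fintype S] [Fintype A] {c π : S → A → ℝ}
    {d : S → ℝ} {M : ℝ} (hπ : IsPolicy π) (hd : IsDist d) (hc : ∀ s a, c s a ∈ Set.Icc 0 M) :
    expCost c π d ∈ Set.Icc 0 M := by
  simpa only [expCost, mul_assoc, ← Finset.mul_sum] using
    hd.sum_mul_mem_Icc fun s => (hπ s).sum_mul_mem_Icc (hc s)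

/-- Discrepancies of expectations of a `[0, M]`-valued function are at most `M` times the
total variation distance. -/
theorem IsDist.abs_sum_sub_mul_le {X : Type*} [Fintype X] {p q : X → ℝ} (hp : IsDist p)
    (hq : IsDist q) {M : ℝ} {v : X → ℝ} (hv : ∀ x, v x ∈ Set.Icc 0 M) :
    |∑ x, (p x - q x) * v x| ≤ M / 2 * ∑ x, |q x - p x| := by
  have hcenter : ∑ x, (p x - q x) * v x = ∑ x, (p x - q x) * (v x - M / 2) := by
    simp only [mul_sub, Finset.sum_sub_distrib, ← Finset.sum_mul, hp.2, hq.2]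
    ring
  rw [hcenter, Finset.mul_sum]
  refine (Finset.abs_sum_le_sum_abs _ _).trans (Finset.sum_le_sum fun x _ => ?_)
  rw [abs_mul, mul_comm, abs_sub_comm (p x)]
  refine mul_le_mul_of_nonneg_right (abs_le.2 ⟨?_, ?_⟩) (abs_nonneg _) <;>
    linarith [(hv x).1, (hv x).2]

section Simulation

variable {S A : Type*} [Fintype S] [Fintype A] {γ : ℝ} {P Q : S → A → S → ℝ} {c π : S → A → ℝ}
  {d : S → ℝ}

theorem summable_pow_mul_expCost (hγ : 0 ≤ γ) (hγ' : γ < 1) (hP : IsDynamics P)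
    (hπ : IsPolicy π) (hc : ∀ s a, c s a ∈ Set.Icc 0 1) (hd : IsDist d) :
    Summable fun t : ℕ => γ ^ t * expCost c π (stateDist P π d t) :=
  summable_pow_mul_of_mem_Icc hγ hγ' fun t => (hd.stateDist hP hπ t).expCost_mem_Icc hπ hc

theorem hasSum_visit (hγ : 0 ≤ γ) (hγ' : γ < 1) (hP : IsDynamics P) (hπ : IsPolicy π)
    (hd : IsDist d) (f : S → A → ℝ) :
    HasSum (fun t : ℕ => γ ^ t * expCost f π (stateDist P π d t))
      ((∑ s, ∑ a, visit γ P π d s * π s a * f s a) / (1 - γ)) := by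
  have h : ∀ s, HasSum (fun t : ℕ => γ ^ t * stateDist P π d t s) (visit γ P π d s / (1 - γ)) := by
    intro s
    rw [visit, mul_div_cancel_left₀ _ (sub_pos.2 hγ').ne']
    exact (summable_pow_mul_of_mem_Icc hγ hγ' fun t =>
      ⟨(hd.stateDist hP hπ t).1 s, (hd.stateDist hP hπ t).le_one s⟩).hasSum
  have hsum := hasSum_sum fun s (_ : s ∈ Finset.univ) =>
    hasSum_sum fun a (_ : a ∈ Finset.univ) => ((h s).mul_right (π s a)).mul_right (f s a)
  have hval : (∑ s, ∑ a, visit γ P π d s * π s a * f s a) / (1 - γ) =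
      ∑ s, ∑ a, visit γ P π d s / (1 - γ) * π s a * f s a := by
    simp only [Finset.sum_div]
    exact Finset.sum_congr rfl fun s _ => Finset.sum_congr rfl fun a _ => by ring
  have hfun : (fun t : ℕ => γ ^ t * expCost f π (stateDist P π d t)) =
      fun t => ∑ s, ∑ a, γ ^ t * stateDist P π d t s * π s a * f s a := by
    funext t
    simp only [expCost, Finset.mul_sum]
    exact Finset.sum_congr rfl fun s _ => Finset.sum_congr rfl fun a _ => by ring
  rw [hval, hfun]
  exact hsum

theorem abs_sum_step_sub_step_mul_le (hP : IsDynamics P) (hQ : IsDynamics Q) (hπ : IsPolicy π)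
    (hd : IsDist d) {M : ℝ} {v : S → ℝ} (hv : ∀ s, v s ∈ Set.Icc 0 M) :
    |∑ s, (step P π d s - step Q π d s) * v s| ≤
      M / 2 * expCost (fun s a => ∑ s', |Q s a s' - P s a s'|) π d := by
  have hswap : ∑ s, (step P π d s - step Q π d s) * v s =
      ∑ s, ∑ a, d s * π s a * ∑ s', (P s a s' - Q s a s') * v s' := by
    simp only [step, ← Finset.sum_sub_distrib, Finset.sum_mul, Finset.mul_sum]
    rw [Finset.sum_comm]
    refine Finset.sum_congr rfl fun s _ => ?_
    rw [Finset.sum_comm]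
    exact Finset.sum_congr rfl fun a _ => Finset.sum_congr rfl fun s' _ => by ring
  rw [hswap, expCost, Finset.mul_sum]
  refine (Finset.abs_sum_le_sum_abs _ _).trans (Finset.sum_le_sum fun s _ => ?_)
  rw [Finset.mul_sum]
  refine (Finset.abs_sum_le_sum_abs _ _).trans (Finset.sum_le_sum fun a _ => ?_)
  have hw : 0 ≤ d s * π s a := mul_nonneg (hd.1 s) ((hπ s).1 a)
  rw [abs_mul, abs_of_nonneg hw, mul_left_comm]
  exact mul_le_mul_of_nonneg_left ((hP s a).abs_sum_sub_mul_le (hQ s a) hv) hw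

variable [DecidableEq S]

theorem Jf_eq_tsum (hγ : 0 ≤ γ) (hγ' : γ < 1) (hP : IsDynamics P)
    (hπ : IsPolicy π) (hc : ∀ s a, c s a ∈ Set.Icc 0 1) (d : S → ℝ) :
    Jf γ P c d π = ∑' t : ℕ, γ ^ t * expCost c π (stateDist P π d t) := by
  have h := hasSum_sum fun s₀ (_ : s₀ ∈ Finset.univ) =>
    (summable_pow_mul_expCost hγ hγ' hP hπ hc (isDist_ite_eq s₀)).hasSum.mul_left (d s₀)
  refine (h.tsum_eq.symm.trans (tsum_congr fun t => ?_))
  rw [expCost_stateDist_eq_sum P c π d t, Finset.mul_sum]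
  exact Finset.sum_congr rfl fun s _ => by ring

/-- The Bellman equation, integrated against a state distribution. -/
theorem Jf_eq_expCost_add (hγ : 0 ≤ γ) (hγ' : γ < 1) (hP : IsDynamics P)
    (hπ : IsPolicy π) (hc : ∀ s a, c s a ∈ Set.Icc 0 1) (hd : IsDist d) :
    Jf γ P c d π = expCost c π d + γ * Jf γ P c (step P π d) π := by
  rw [Jf_eq_tsum hγ hγ' hP hπ hc, Jf_eq_tsum hγ hγ' hP hπ hc,
    (summable_pow_mul_expCost hγ hγ' hP hπ hc hd).tsum_eq_zero_add, ← tsum_mul_left]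
  simp only [stateDist_succ', stateDist_zero, pow_zero, one_mul, pow_succ', mul_assoc]

theorem Vf_mem_Icc (hγ : 0 ≤ γ) (hγ' : γ < 1) (hP : IsDynamics P)
    (hπ : IsPolicy π) (hc : ∀ s a, c s a ∈ Set.Icc 0 1) (s : S) :
    Vf γ P c π s ∈ Set.Icc 0 (1 - γ)⁻¹ := by
  have h := fun t => ((isDist_ite_eq s).stateDist hP hπ t).expCost_mem_Icc hπ hc
  refine ⟨tsum_nonneg fun t => mul_nonneg (pow_nonneg hγ t) (h t).1, ?_⟩
  rw [← tsum_geometric_of_lt_one hγ hγ']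
  exact (summable_pow_mul_expCost hγ hγ' hP hπ hc (isDist_ite_eq s)).tsum_le_tsum
    (fun t => mul_le_of_le_one_right (pow_nonneg hγ t) (h t).2)
    (summable_geometric_of_lt_one hγ hγ')

/-- The simulation lemma: the cost of a policy under two dynamics differs by at most the
discounted model error along the visitation distribution of the first. -/
theorem abs_Jf_sub_Jf_le (hγ : 0 ≤ γ) (hγ' : γ < 1) (hP : IsDynamics P) (hQ : IsDynamics Q)
    (hπ : IsPolicy π) (hc : ∀ s a, c s a ∈ Set.Icc 0 1) (hd : IsDist d) :
    |Jf γ P c d π - Jf γ Q c d π| ≤ γ / (2 * (1 - γ) ^ 2) *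
      ∑ s, ∑ a, visit γ P π d s * π s a * ∑ s', |Q s a s' - P s a s'| := by
  have hdist := hd.stateDist hP hπ
  have hV := Vf_mem_Icc hγ hγ' hQ hπ hc
  have hu : Summable fun t => γ ^ t * Jf γ Q c (stateDist P π d t) π :=
    summable_pow_mul_of_mem_Icc hγ hγ' fun t => (hdist t).sum_mul_mem_Icc hV
  have hshift : HasSum (fun t => γ ^ (t + 1) * Jf γ Q c (stateDist P π d (t + 1)) π)
      (∑' t, γ ^ t * Jf γ Q c (stateDist P π d t) π - Jf γ Q c d π) := by
    simpa [stateDist] using (hasSum_nat_add_iff' 1).2 hu.hasSum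
  have hJ := (summable_pow_mul_expCost hγ hγ' hP hπ hc hd).hasSum
  rw [← Jf_eq_tsum hγ hγ' hP hπ hc] at hJ
  have hdiff := hJ.sub (hu.hasSum.sub hshift)
  rw [sub_sub_cancel] at hdiff
  have herr := (hasSum_visit hγ hγ' hP hπ hd fun s a => ∑ s', |Q s a s' - P s a s'|).mul_left
    (γ * ((1 - γ)⁻¹ / 2))
  have hterm : ∀ t, ‖γ ^ t * expCost c π (stateDist P π d t) -
      (γ ^ t * Jf γ Q c (stateDist P π d t) π -
        γ ^ (t + 1) * Jf γ Q c (stateDist P π d (t + 1)) π)‖ ≤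
      γ * ((1 - γ)⁻¹ / 2) * (γ ^ t * expCost (fun s a => ∑ s', |Q s a s' - P s a s'|) π
        (stateDist P π d t)) := by
    intro t
    have hrw : γ ^ t * expCost c π (stateDist P π d t) -
        (γ ^ t * Jf γ Q c (stateDist P π d t) π -
          γ ^ (t + 1) * Jf γ Q c (stateDist P π d (t + 1)) π) =
        γ ^ (t + 1) * ∑ s, (step P π (stateDist P π d t) s - step Q π (stateDist P π d t) s) *
          Vf γ Q c π s := by
      rw [Jf_eq_expCost_add hγ hγ' hQ hπ hc (hdist t)]
      simp only [Jf, stateDist, sub_mul, Finset.sum_sub_distrib]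
      ring
    rw [hrw, Real.norm_eq_abs, abs_mul, abs_of_nonneg (pow_nonneg hγ _)]
    refine (mul_le_mul_of_nonneg_left (abs_sum_step_sub_step_mul_le hP hQ hπ (hdist t) hV)
      (pow_nonneg hγ _)).trans_eq ?_
    ring
  have hle := tsum_of_norm_bounded herr hterm
  rw [hdiff.tsum_eq, Real.norm_eq_abs] at hle
  refine hle.trans_eq ?_
  have hne : 1 - γ ≠ 0 := (sub_pos.2 hγ').ne'
  field_simp

end Simulation

/-- **Appendix lemma for Theorem 1.** If `η_n` minimizes `Ĵ` (cost under the model `P̂`)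
over the trust region `T = {π : E_{s∼d_{π_n}}[D_TV(π(·|s), π_n(·|s))] ≤ α}` and `η*_n ∈ T`,
then `J(η_n) - J(η*_n)` is bounded by the model errors under both visitation distributions. -/
theorem trust_region_model_gap
    {S A : Type*} [Fintype S] [Fintype A] [DecidableEq S]
    (γ : ℝ) (P Phat : S → A → S → ℝ) (c : S → A → ℝ) (ρ₀ : S → ℝ)
    (hγ : 0 < γ) (hγ' : γ < 1) (hP : IsDynamics P) (hPhat : IsDynamics Phat) (hρ : IsDist ρ₀)
    (hc : ∀ s a, 0 ≤ c s a ∧ c s a ≤ 1)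
    (πn ηn ηstar : S → A → ℝ)
    (hπn : IsPolicy πn) (hηn : IsPolicy ηn) (hηstar : IsPolicy ηstar)
    (α : ℝ) (hα : 0 ≤ α)
    (hηnT : ∑ s, visit γ P πn ρ₀ s * ((∑ a, |ηn s a - πn s a|) / 2) ≤ α)
    (hηstarT : ∑ s, visit γ P πn ρ₀ s * ((∑ a, |ηstar s a - πn s a|) / 2) ≤ α)
    (hmin : ∀ π : S → A → ℝ, IsPolicy π →
      (∑ s, visit γ P πn ρ₀ s * ((∑ a, |π s a - πn s a|) / 2) ≤ α) →
      Jf γ Phat c ρ₀ ηn ≤ Jf γ Phat c ρ₀ π) :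
    Jf γ P c ρ₀ ηn - Jf γ P c ρ₀ ηstar ≤
      (γ / (2 * (1 - γ) ^ 2)) *
        ((∑ s, ∑ a, visit γ P ηn ρ₀ s * ηn s a * (∑ s', |Phat s a s' - P s a s'|)) +
          ∑ s, ∑ a, visit γ P ηstar ρ₀ s * ηstar s a * (∑ s', |Phat s a s' - P s a s'|)) := by
  have hn := abs_Jf_sub_Jf_le hγ.le hγ' hP hPhat hηn hc hρ
  have hstar := abs_Jf_sub_Jf_le hγ.le hγ' hP hPhat hηstar hc hρ
  rw [mul_add]
  linarith [(abs_le.1 hn).2, (abs_le.1 hstar).1, hmin ηstar hηstar hηstarT]
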